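/- arXiv:1504.05406 — 7 statements merged into one kernel-verified Lean document; each statement's English description precedes it below -/
import Mathlib

section
/- Let F be an algebraically closed field of characteristic 0 and let D be a finite-dimensional semisimple F-algebra equipped with an F-linear involution d ↦ d*. Then D is generated as an F-algebra by the set of elements d ∈ D satisfying d·d* = 1; that is, the F-subalgebra of D generated by {d ∈ D | d·d* = 1} is all of D. -/
/-- Semisimple rings are von Neumann regular. -/
theorem IsSemisimpleRing.exists_mul_mul_self_eq {D : Type*} [Ring D] [IsSemisimpleRing D] (x : D) :
    ∃ y : D, x * y * x = x := by
  obtain ⟨e, he, h⟩ := IsSemisimpleRing.ideal_eq_span_idempotent (Ideal.span {x})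
  obtain ⟨y, hy⟩ : ∃ y, y * x = e :=
    Ideal.mem_span_singleton'.1 (h ▸ Ideal.mem_span_singleton_self e)
  obtain ⟨a, ha⟩ : ∃ a, a * e = x :=
    Ideal.mem_span_singleton'.1 (h ▸ Ideal.mem_span_singleton_self x)
  exact ⟨y, by rw [mul_assoc, hy, ← ha, mul_assoc, he.eq]⟩

/-- A central nilpotent element of a semisimple ring vanishes. -/
theorem IsSemisimpleRing.eq_zero_of_isNilpotent_of_central {D : Type*} [Ring D]
    [IsSemisimpleRing D] {z : D} (hz : ∀ d, z * d = d * z) (hn : IsNilpotent z) : z = 0 := by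
  obtain ⟨n, hn⟩ := hn
  obtain ⟨y, hy⟩ := exists_mul_mul_self_eq z
  have key : ∀ k : ℕ, z * (z * y) ^ k = z := by
    intro k
    induction k with
    | zero => simp
    | succ k ih => rw [pow_succ, ← mul_assoc, ih, hz (z * y), hy]
  rw [← key n, Commute.mul_pow (hz y), hn, zero_mul, mul_zero]

section TraceForm

variable (F : Type*) [Field F] {D : Type*} [Ring D] [Algebra F D]

/-- The sum of the traces of the left and the right regular representations. -/
noncomputable def biregularTrace : D →ₗ[F] F :=
  LinearMap.trace F D ∘ₗ LinearMap.mul F D + LinearMap.trace F D ∘ₗ (LinearMap.mul F D).flip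

theorem biregularTrace_apply (x : D) : biregularTrace F x =
    LinearMap.trace F D (LinearMap.mulLeft F x) + LinearMap.trace F D (LinearMap.mulRight F x) :=
  rfl

theorem biregularTrace_mul_comm (x y : D) :
    biregularTrace F (x * y) = biregularTrace F (y * x) := by
  simp only [biregularTrace_apply, LinearMap.mulLeft_mul, LinearMap.mulRight_mul]
  rw [← Module.End.mul_eq_comp, LinearMap.trace_mul_comm, ← Module.End.mul_eq_comp,
    LinearMap.trace_mul_comm F (LinearMap.mulRight F y)]
  rfl

theorem biregularTrace_involution (s : D →ₗ[F] D) (hinv : ∀ d, s (s d) = d)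
    (hmul : ∀ d₁ d₂, s (d₁ * d₂) = s d₂ * s d₁) (x : D) :
    biregularTrace F (s x) = biregularTrace F x := by
  have hss : s * s = 1 := LinearMap.ext hinv
  have hL : LinearMap.mulLeft F (s x) = s * LinearMap.mulRight F x * s := by
    ext d; simp [hmul, hinv]
  have hR : LinearMap.mulRight F (s x) = s * LinearMap.mulLeft F x * s := by
    ext d; simp [hmul, hinv]
  have conj : ∀ f : Module.End F D,
      LinearMap.trace F D (s * f * s) = LinearMap.trace F D f := fun f => by
    rw [LinearMap.trace_mul_comm, ← mul_assoc, hss, one_mul]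
  rw [biregularTrace_apply, biregularTrace_apply, hL, hR, conj, conj, add_comm]

theorem biregularTrace_ne_zero [CharZero F] [FiniteDimensional F D] {e : D}
    (he : IsIdempotentElem e) (h0 : e ≠ 0) : biregularTrace F e ≠ 0 := by
  have hL : IsIdempotentElem (LinearMap.mulLeft F e) := by
    ext d; simp [← mul_assoc, he.eq]
  have hR : IsIdempotentElem (LinearMap.mulRight F e) := by
    ext d; simp [mul_assoc, he.eq]
  rw [biregularTrace_apply, (LinearMap.IsIdempotentElem.isProj_range _ hL).trace,
    (LinearMap.IsIdempotentElem.isProj_range _ hR).trace]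
  norm_cast
  intro h
  have h1 := Submodule.finrank_eq_zero.1 (Nat.eq_zero_of_add_eq_zero_right h)
  rw [LinearMap.range_eq_bot] at h1
  exact h0 (by simpa using LinearMap.congr_fun h1 1)

theorem exists_biregularTrace_mul_ne_zero [CharZero F] [FiniteDimensional F D]
    [IsSemisimpleRing D] {x : D} (hx : x ≠ 0) : ∃ y, biregularTrace F (x * y) ≠ 0 := by
  obtain ⟨y, hy⟩ := IsSemisimpleRing.exists_mul_mul_self_eq x
  refine ⟨y, biregularTrace_ne_zero F (e := x * y) ?_ ?_⟩
  · rw [IsIdempotentElem, ← mul_assoc, hy]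
  · rintro h
    rw [h, zero_mul] at hy
    exact hx hy.symm

/-- A proper subspace has a nonzero element in its orthogonal for the trace form. -/
theorem exists_ne_zero_biregularTrace_mul_eq_zero [CharZero F] [FiniteDimensional F D]
    [IsSemisimpleRing D] {V : Submodule F D} (hV : V ≠ ⊤) :
    ∃ x : D, x ≠ 0 ∧ ∀ a ∈ V, biregularTrace F (x * a) = 0 := by
  let B : D →ₗ[F] Module.Dual F D := (LinearMap.mul F D).compr₂ (biregularTrace F)
  have hB : Function.Injective B := by
    rw [← LinearMap.ker_eq_bot, LinearMap.ker_eq_bot']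
    intro x hx
    by_contra h
    obtain ⟨y, hy⟩ := exists_biregularTrace_mul_ne_zero F h
    exact hy (LinearMap.congr_fun hx y)
  obtain ⟨f, hf0, hf⟩ := V.exists_le_ker_of_lt_top (lt_top_iff_ne_top.2 hV)
  obtain ⟨x, hx⟩ := (LinearMap.injective_iff_surjective_of_finrank_eq_finrank
    (Subspace.dual_finrank_eq (K := F) (V := D)).symm).1 hB f
  refine ⟨x, ?_, fun a ha => ?_⟩
  · rintro rfl
    exact hf0 (by rw [← hx, map_zero])
  · exact (LinearMap.congr_fun hx a).trans (hf ha)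

end TraceForm

/-- A subalgebra containing the inverse of an element contains that element. -/
theorem Subalgebra.mem_of_mul_eq_one {F D : Type*} [Field F] [Ring D] [Algebra F D]
    [FiniteDimensional F D] (A : Subalgebra F D) {x y : D} (hxy : x * y = 1) (hy : y ∈ A) : x ∈ A := by
  have hinj : Function.Injective (LinearMap.mulLeft F (⟨y, hy⟩ : A)) := by
    intro a b hab
    have h : y * (a : D) = y * b := congrArg Subtype.val hab
    apply Subtype.ext
    rw [← one_mul (a : D), ← hxy, mul_assoc, h, ← mul_assoc, hxy, one_mul]
  obtain ⟨a, ha⟩ := LinearMap.injective_iff_surjective.1 hinj 1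
  have h : y * (a : D) = 1 := congrArg Subtype.val ha
  rw [← mul_one x, ← h, ← mul_assoc, hxy, one_mul]
  exact a.2

/-- A nonzero central element `z` has a nonzero eigenvalue whose eigenspace contains a nonzero
idempotent which is a polynomial in `z`. -/
theorem exists_aeval_isIdempotentElem_of_central (F : Type*) {D : Type*} [Field F] [IsAlgClosed F]
    [Ring D] [Algebra F D] [FiniteDimensional F D] [IsSemisimpleRing D] {z : D}
    (hz : ∀ d, z * d = d * z) (h0 : z ≠ 0) :
    ∃ (c : F) (q : Polynomial F), c ≠ 0 ∧ Polynomial.aeval z q ≠ 0 ∧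
      IsIdempotentElem (Polynomial.aeval z q) ∧
      z * Polynomial.aeval z q = c • Polynomial.aeval z q := by
  have hint : IsIntegral F z := Algebra.IsIntegral.isIntegral z
  have hmonic := minpoly.monic hint
  have hcomm : ∀ (q : Polynomial F) (d : D),
      Polynomial.aeval z q * d = d * Polynomial.aeval z q := fun q d => by
    have h : z ∈ Subalgebra.centralizer F {d} := by
      rw [Subalgebra.mem_centralizer_iff]
      rintro _ rfl
      exact (hz _).symm
    have hq := Algebra.adjoin_le (Set.singleton_subset_iff.2 h)
      (Polynomial.aeval_mem_adjoin_singleton (p := q) F z)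
    exact ((Subalgebra.mem_centralizer_iff F).1 hq d rfl).symm
  obtain ⟨c, hc, hc0⟩ : ∃ c ∈ (minpoly F z).roots, c ≠ 0 := by
    by_contra! h
    have hp := (IsAlgClosed.splits (minpoly F z)).eq_prod_roots_of_monic hmonic
    rw [Multiset.eq_replicate_of_mem h] at hp
    have h1 := minpoly.aeval F z
    rw [hp] at h1
    refine h0 (IsSemisimpleRing.eq_zero_of_isNilpotent_of_central hz
      ⟨Multiset.card (minpoly F z).roots, ?_⟩)
    simpa using h1
  obtain ⟨q, hq⟩ := Polynomial.dvd_iff_isRoot.2 (Polynomial.isRoot_of_mem_roots hc)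
  set w := Polynomial.aeval z q with hw
  have hzw : z * w = c • w := by
    have h1 := minpoly.aeval F z
    rw [hq, map_mul, map_sub, Polynomial.aeval_X, Polynomial.aeval_C, sub_mul, sub_eq_zero,
      ← Algebra.smul_def] at h1
    exact h1
  have hw0 : w ≠ 0 := by
    intro h
    have hq0 : q ≠ 0 := by
      rintro rfl
      exact hmonic.ne_zero (by rw [hq, mul_zero])
    have h1 := Polynomial.natDegree_le_of_dvd (minpoly.dvd F z h) hq0
    rw [hq, Polynomial.natDegree_mul (Polynomial.X_sub_C_ne_zero c) hq0,
      Polynomial.natDegree_X_sub_C] at h1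
    lia
  have hpw : ∀ p : Polynomial F, Polynomial.aeval z p * w = p.eval c • w := by
    intro p
    obtain ⟨r, hr⟩ := Polynomial.X_sub_C_dvd_sub_C_eval (a := c) (p := p)
    have h2 : (Polynomial.aeval z p - algebraMap F D (p.eval c)) * w = 0 := by
      have := congrArg (Polynomial.aeval z) hr
      rw [mul_comm, map_sub, map_mul, Polynomial.aeval_C, map_sub, Polynomial.aeval_X,
        Polynomial.aeval_C] at this
      rw [this, mul_assoc, sub_mul, hzw, Algebra.smul_def, sub_self, mul_zero]
    rw [sub_mul, sub_eq_zero] at h2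
    rw [h2, Algebra.smul_def]
  have hqc : q.eval c ≠ 0 := by
    intro h
    refine hw0 (IsSemisimpleRing.eq_zero_of_isNilpotent_of_central (hcomm q) ⟨2, ?_⟩)
    rw [pow_two, hpw q, h, zero_smul]
  have he : Polynomial.aeval z ((q.eval c)⁻¹ • q) = (q.eval c)⁻¹ • w := by rw [map_smul]
  refine ⟨c, (q.eval c)⁻¹ • q, hc0, ?_, ?_, ?_⟩
  · rw [he]
    exact smul_ne_zero (inv_ne_zero hqc) hw0
  · rw [he, IsIdempotentElem, smul_mul_smul_comm, hpw q, smul_smul, mul_assoc,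
      inv_mul_cancel₀ hqc, mul_one]
  · rw [he, mul_smul_comm, hzw, smul_comm]

section Involution

variable {F : Type*} [Field F] {D : Type*} [Ring D] [Algebra F D]
  {s : D →ₗ[F] D}

theorem involution_one (hinv : ∀ d, s (s d) = d)
    (hmul : ∀ d₁ d₂, s (d₁ * d₂) = s d₂ * s d₁) : s 1 = 1 := by
  have h := hmul (s 1) 1
  rwa [mul_one, hinv, mul_one, eq_comm] at h

theorem involution_aeval (hinv : ∀ d, s (s d) = d)
    (hmul : ∀ d₁ d₂, s (d₁ * d₂) = s d₂ * s d₁) {z : D} (hz : s z = z) (q : Polynomial F) :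
    s (Polynomial.aeval z q) = Polynomial.aeval z q := by
  have hpow : ∀ n : ℕ, s (z ^ n) = z ^ n := by
    intro n
    induction n with
    | zero => simpa using involution_one hinv hmul
    | succ n ih => rw [pow_succ, hmul, ih, hz, ← pow_succ', pow_succ]
  induction q using Polynomial.induction_on' with
  | add p q hp hq => rw [map_add, map_add, hp, hq]
  | monomial n a => rw [Polynomial.aeval_monomial, ← Algebra.smul_def, map_smul, hpow]

/-- The Cayley transform shows that skew elements lie in the algebra generated by the unitaries. -/
theorem skew_mem_adjoin_unitaries [CharZero F] [FiniteDimensional F D]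
    (hinv : ∀ d, s (s d) = d)
    (hmul : ∀ d₁ d₂, s (d₁ * d₂) = s d₂ * s d₁) {k : D} (hk : s k = -k) :
    k ∈ Algebra.adjoin F {d : D | d * s d = 1} := by
  have h1 := involution_one hinv hmul
  obtain ⟨c, hc0, y, hmy, hym⟩ : ∃ c : F, c ≠ 0 ∧ ∃ y : D,
      (algebraMap F D c - k) * y = 1 ∧ y * (algebraMap F D c - k) = 1 := by
    obtain ⟨c, hc⟩ := ((Module.End.finite_spectrum (LinearMap.mulLeft F k)).union
      (Set.finite_singleton 0)).exists_notMem
    rw [Set.mem_union, not_or] at hc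
    obtain ⟨y, hy⟩ := ((Module.End.isUnit_iff _).1 (spectrum.notMem_iff.1 hc.1)).2 1
    have hcy : (algebraMap F D c - k) * y = 1 := by
      rw [← hy, sub_mul, ← Algebra.smul_def]
      rfl
    have : IsNoetherian D D := isNoetherian_of_tower F (inferInstance : IsNoetherian F D)
    exact ⟨c, hc.2, y, hcy, mul_eq_one_symm hcy⟩
  set C := algebraMap F D c with hC
  have hsC : s C = C := by rw [hC, Algebra.algebraMap_eq_smul_one, map_smul, h1]
  have hCk : C * k = k * C := Algebra.commutes c k
  have hpy : (C + k) * s y = 1 := by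
    have := congrArg s hym
    rwa [hmul, map_sub, hsC, hk, sub_neg_eq_add, h1] at this
  have hyp : s y * (C + k) = 1 := by
    have := congrArg s hmy
    rwa [hmul, map_sub, hsC, hk, sub_neg_eq_add, h1] at this
  have hu : (C + k) * y ∈ Algebra.adjoin F {d : D | d * s d = 1} := by
    apply Algebra.subset_adjoin
    have e1 : (C + k) * y = y * (C + k) := by
      have e2 : (C - k) * (C + k) = (C + k) * (C - k) := by
        simp only [mul_add, add_mul, mul_sub, sub_mul, hCk]
        abel
      calc (C + k) * y = y * ((C - k) * (C + k)) * y := by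
            rw [← mul_assoc, hym, one_mul]
        _ = y * (C + k) := by rw [e2, mul_assoc, mul_assoc, hmy, mul_one]
    change (C + k) * y * s ((C + k) * y) = 1
    rw [hmul, map_add, hsC, hk, ← sub_eq_add_neg, e1, mul_assoc, ← mul_assoc (C + k), hpy,
      one_mul, hym]
  have h2c : (2 * c) • y ∈ Algebra.adjoin F {d : D | d * s d = 1} := by
    have : (2 * c) • y = 1 + (C + k) * y := by
      rw [← hmy, ← add_mul, Algebra.smul_def, map_mul, map_ofNat, ← hC, two_mul]
      congr 1
      abel
    rw [this]
    exact add_mem (one_mem _) hu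
  have hyA : y ∈ Algebra.adjoin F {d : D | d * s d = 1} := by
    have := Subalgebra.smul_mem _ h2c (2 * c)⁻¹
    rwa [smul_smul, inv_mul_cancel₀ (mul_ne_zero two_ne_zero hc0), one_smul] at this
  have hm := Subalgebra.mem_of_mul_eq_one _ hmy hyA
  have := sub_mem (Subalgebra.algebraMap_mem (Algebra.adjoin F {d : D | d * s d = 1}) c) hm
  rwa [← hC, sub_sub_cancel] at this

/-- A symmetric element `g` whose square is an idempotent fixing `g` lies in the algebra generated
by the unitaries. -/
theorem mem_adjoin_unitaries_of_cube_eq_self [CharZero F] (hinv : ∀ d, s (s d) = d)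
    (hmul : ∀ d₁ d₂, s (d₁ * d₂) = s d₂ * s d₁) {g : D} (hg : s g = g) (h3 : g * g * g = g) :
    g ∈ Algebra.adjoin F {d : D | d * s d = 1} := by
  have h1 := involution_one hinv hmul
  have key : ∀ g : D, s g = g → g * g * g = g →
      1 - g * g - g ∈ Algebra.adjoin F {d : D | d * s d = 1} := by
    intro g hg h3
    apply Algebra.subset_adjoin
    change (1 - g * g - g) * s (1 - g * g - g) = 1
    rw [mul_assoc] at h3
    have h4 : g * (g * (g * g)) = g * g := by rw [h3]
    rw [map_sub, map_sub, hmul, h1, hg]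
    simp only [mul_sub, sub_mul, one_mul, mul_one, mul_assoc, h3]
    abel
  have h := sub_mem (key (-g) (by rw [map_neg, hg]) (by simp [h3])) (key g hg h3)
  have h2 : (1 - -g * -g - -g) - (1 - g * g - g) = (2 : F) • g := by
    rw [two_smul, neg_mul_neg]; abel
  rw [h2] at h
  have := Subalgebra.smul_mem _ h (2 : F)⁻¹
  rwa [smul_smul, inv_mul_cancel₀ two_ne_zero, one_smul] at this

theorem involution_mem_adjoin_unitaries [FiniteDimensional F D] (hinv : ∀ d, s (s d) = d)
    (hmul : ∀ d₁ d₂, s (d₁ * d₂) = s d₂ * s d₁) {a : D}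
    (ha : a ∈ Algebra.adjoin F {d : D | d * s d = 1}) :
    s a ∈ Algebra.adjoin F {d : D | d * s d = 1} := by
  induction ha using Algebra.adjoin_induction with
  | mem x hx =>
    apply Algebra.subset_adjoin
    have : IsNoetherian D D := isNoetherian_of_tower F (inferInstance : IsNoetherian F D)
    rw [Set.mem_ofPred_eq, hinv]
    exact mul_eq_one_symm hx
  | algebraMap r =>
    rw [Algebra.algebraMap_eq_smul_one, map_smul, involution_one hinv hmul]
    exact Subalgebra.smul_mem _ (one_mem _) r
  | add x y _ _ hx hy => rw [map_add]; exact add_mem hx hy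
  | mul x y _ _ hx hy => rw [hmul]; exact mul_mem hy hx

/-- A symmetric element of square zero in a semisimple algebra has a symmetric generalized inverse
of square zero. -/
theorem exists_symm_sq_zero_mul_mul_self_eq [CharZero F] [IsSemisimpleRing D]
    (hinv : ∀ d, s (s d) = d)
    (hmul : ∀ d₁ d₂, s (d₁ * d₂) = s d₂ * s d₁) {x : D} (hx : s x = x) (hxx : x * x = 0) :
    ∃ u : D, s u = u ∧ u * u = 0 ∧ x * u * x = x ∧ u * x * u = u := by
  have h1 := involution_one hinv hmul
  obtain ⟨y, hy⟩ := IsSemisimpleRing.exists_mul_mul_self_eq x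
  have hy' : x * s y * x = x := by
    have := congrArg s hy
    rwa [hmul, hmul, hx, ← mul_assoc] at this
  obtain ⟨t, ht, hts⟩ : ∃ t : D, x * t * x = x ∧ s t = t := by
    refine ⟨(2 : F)⁻¹ • (y + s y), ?_, by rw [map_smul, map_add, hinv, add_comm (s y)]⟩
    rw [mul_smul_comm, smul_mul_assoc, mul_add, add_mul, hy, hy', ← two_smul F x, smul_smul,
      inv_mul_cancel₀ two_ne_zero, one_smul]
  obtain ⟨h, hh, hxh, hhx⟩ : ∃ h : D, s h = h ∧ x * h * x = x ∧ h * x * h = h := by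
    refine ⟨t * x * t, by simp only [hmul, hts, hx, mul_assoc], ?_, ?_⟩
    · rw [← mul_assoc, ← mul_assoc, ht, ht]
    · calc t * x * t * x * (t * x * t) = t * (x * t * x) * t * x * t := by simp only [mul_assoc]
        _ = t * (x * t * x) * t := by simp only [ht, mul_assoc]
        _ = t * x * t := by rw [ht]
  have a1 : ∀ d, x * (x * d) = 0 := fun d => by rw [← mul_assoc, hxx, zero_mul]
  have a3 : ∀ d, h * (x * (h * d)) = h * d := fun d => by rw [← mul_assoc, ← mul_assoc, hhx]
  rw [mul_assoc] at hxh hhx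
  refine ⟨(1 - (2 : F)⁻¹ • (x * h)) * h * (1 - (2 : F)⁻¹ • (h * x)), ?_, ?_, ?_, ?_⟩
  · simp only [map_sub, map_smul, hmul, h1, hh, hx, mul_assoc]
  all_goals
    simp only [mul_sub, sub_mul, one_mul, mul_one, mul_assoc, smul_mul_assoc, mul_smul_comm,
      hxx, hxh, hhx, a1, a3, mul_zero, zero_mul, smul_zero]
    module

end Involution

/-- Let `F` be an algebraically closed field of characteristic `0` and let `D` be a
finite-dimensional semisimple `F`-algebra equipped with an `F`-linear involution `d ↦ d*`
(an `F`-linear map `s` with `s (s d) = d` and `s (d₁ * d₂) = s d₂ * s d₁`).  Then `D` is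
generated as an `F`-algebra by the elements `d` with `d * d* = 1`. -/
theorem semisimple_algebra_adjoin_involution_unitaries_eq_top
    (F : Type*) [Field F] [IsAlgClosed F] [CharZero F]
    (D : Type*) [Ring D] [Algebra F D] [FiniteDimensional F D] [IsSemisimpleRing D]
    (s : D →ₗ[F] D)
    (hinv : ∀ d : D, s (s d) = d)
    (hmul : ∀ d₁ d₂ : D, s (d₁ * d₂) = s d₂ * s d₁) :
    Algebra.adjoin F {d : D | d * s d = 1} = ⊤ := by
  by_contra hne
  set A := Algebra.adjoin F {d : D | d * s d = 1} with hA
  obtain ⟨x, hx0, hx⟩ := exists_ne_zero_biregularTrace_mul_eq_zero F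
    (V := Subalgebra.toSubmodule A) (by simpa using hne)
  replace hx : ∀ a ∈ A, biregularTrace F (x * a) = 0 := hx
  have hskew : ∀ {k : D}, s k = -k → k ∈ A := skew_mem_adjoin_unitaries hinv hmul
  have hsplit : ∀ d : D, ∃ h k : D, s h = h ∧ s k = -k ∧ d = h + k := fun d =>
    ⟨(2 : F)⁻¹ • (d + s d), (2 : F)⁻¹ • (d - s d),
      by rw [map_smul, map_add, hinv, add_comm],
      by rw [map_smul, map_sub, hinv, ← smul_neg, neg_sub],
      by rw [← smul_add, add_add_sub_cancel, ← two_smul F d, smul_smul,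
          inv_mul_cancel₀ two_ne_zero, one_smul]⟩
  have hstar : ∀ w : D, (∀ a ∈ A, biregularTrace F (w * a) = 0) →
      ∀ a ∈ A, biregularTrace F (s w * a) = 0 := by
    intro w hw a ha
    rw [← hinv a, ← hmul, biregularTrace_involution F s hinv hmul, biregularTrace_mul_comm]
    exact hw _ (involution_mem_adjoin_unitaries hinv hmul ha)
  have hsymm : ∀ w : D, (∀ a ∈ A, biregularTrace F (w * a) = 0) → s w = w := by
    intro w hw
    have hk : s (w - s w) = -(w - s w) := by rw [map_sub, hinv, neg_sub]
    by_contra h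
    obtain ⟨y, hy⟩ := exists_biregularTrace_mul_ne_zero F (sub_ne_zero.2 (Ne.symm h))
    obtain ⟨p, q, hp, hq, rfl⟩ := hsplit y
    apply hy
    have e1 : biregularTrace F ((w - s w) * q) = 0 := by
      rw [sub_mul, map_sub, hw q (hskew hq), hstar w hw q (hskew hq), sub_zero]
    have e2 : biregularTrace F ((w - s w) * p) = 0 := by
      have := biregularTrace_involution F s hinv hmul ((w - s w) * p)
      rw [hmul, hk, hp, mul_neg, map_neg, biregularTrace_mul_comm] at this
      exact self_eq_neg.1 this.symm
    rw [mul_add, map_add, e1, e2, add_zero]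
  have hsx := hsymm x hx
  have hanti : ∀ k : D, s k = -k → x * k = -(k * x) := by
    intro k hk
    have h := hsymm (x * k) fun a ha => by
      rw [mul_assoc]
      exact hx _ (mul_mem (hskew hk) ha)
    rw [hmul, hsx, hk, neg_mul] at h
    exact h.symm
  have hcentral : ∀ d : D, x * x * d = d * (x * x) := by
    intro d
    obtain ⟨h, k, hh, hk, rfl⟩ := hsplit d
    have e1 := hanti k hk
    have e2 := hanti (x * h - h * x) (by rw [map_sub, hmul, hmul, hh, hsx, neg_sub])
    have e3 : x * x * h = h * (x * x) := by
      have e3 : x * (x * h) - x * (h * x) = h * (x * x) - x * (h * x) := by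
        simpa only [mul_sub, sub_mul, mul_assoc, neg_sub] using e2
      rw [mul_assoc, sub_left_injective e3]
    have e4 : x * x * k = k * (x * x) := by
      rw [mul_assoc, e1, mul_neg, ← mul_assoc, e1, neg_mul, neg_neg, mul_assoc]
    rw [mul_add, add_mul, e3, e4]
  have hxx : x * x = 0 := by
    by_contra hz
    obtain ⟨c, q, hc, he0, he, hze⟩ := exists_aeval_isIdempotentElem_of_central F hcentral hz
    have hse := involution_aeval hinv hmul (z := x * x) (by rw [hmul, hsx]) q
    have hxe : x * Polynomial.aeval (x * x) q = Polynomial.aeval (x * x) q * x := by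
      have h := Algebra.adjoin_le (S := Subalgebra.centralizer F {x})
        (Set.singleton_subset_iff.2 ((Subalgebra.mem_centralizer_iff F).2
          (by rintro _ rfl; exact (mul_assoc _ _ _).symm)))
        (Polynomial.aeval_mem_adjoin_singleton (p := q) F (x * x))
      exact (Subalgebra.mem_centralizer_iff F).1 h x rfl
    set e := Polynomial.aeval (x * x) q
    obtain ⟨m, hm⟩ := IsAlgClosed.exists_pow_nat_eq c (n := 2) (by norm_num)
    have hm0 : m ≠ 0 := by rintro rfl; exact hc (by rw [← hm]; simp)
    have hg : m⁻¹ • (x * e) ∈ A := by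
      apply mem_adjoin_unitaries_of_cube_eq_self hinv hmul
      · rw [map_smul, hmul, hse, hsx, hxe]
      · have e1 : x * e * (x * e) = c • e := by
          nth_rewrite 1 [hxe]
          rw [mul_assoc, ← mul_assoc x x e, hze, mul_smul_comm, he.eq]
        rw [smul_mul_smul_comm, e1, smul_smul, smul_mul_smul_comm, hxe, ← mul_assoc, he.eq, ← hm]
        congr 1
        field_simp
    have h := hx _ hg
    rw [mul_smul_comm, ← mul_assoc, hze, map_smul, map_smul, smul_eq_mul, smul_eq_mul] at h
    exact mul_ne_zero (inv_ne_zero hm0) (mul_ne_zero hc (biregularTrace_ne_zero F he he0)) h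
  obtain ⟨u, hu, huu, hxu, hux⟩ := exists_symm_sq_zero_mul_mul_self_eq hinv hmul hsx hxx
  have hg : x + u ∈ A := mem_adjoin_unitaries_of_cube_eq_self hinv hmul
    (by rw [map_add, hsx, hu])
    (by simp only [mul_add, add_mul, hxx, huu, hxu, hux, mul_assoc u x x, mul_assoc x u u,
          mul_zero, add_zero, zero_add])
  have h := hx _ hg
  rw [mul_add, hxx, zero_add] at h
  refine biregularTrace_ne_zero F (e := x * u) ?_ ?_ h
  · rw [IsIdempotentElem, ← mul_assoc, hxu]
  · intro h
    rw [h, zero_mul] at hxu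
    exact hx0 hxu.symm
end

section
/- Let F be an algebraically closed field of characteristic 0 and n a positive integer. The F-subalgebra of the matrix algebra Mₙ(F) generated by the orthogonal group {A ∈ Mₙ(F) | A·Aᵀ = 1} is all of Mₙ(F). -/
namespace Matrix

variable {n R : Type*} [Fintype n] [DecidableEq n] [CommRing R]

theorem one_sub_two_smul_single_mul_transpose (i : n) :
    (1 - (2 : R) • single i i (1 : R)) * (1 - (2 : R) • single i i (1 : R)).transpose = 1 := by
  simp only [transpose_sub, transpose_one, transpose_smul, transpose_single, sub_mul, mul_sub,
    one_mul, mul_one, smul_mul_smul_comm, single_mul_single_same]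
  module

theorem permMatrix_mul_transpose (σ : Equiv.Perm n) :
    σ.permMatrix R * (σ.permMatrix R).transpose = 1 := by
  rw [transpose_permMatrix, ← permMatrix_mul, inv_mul_cancel, permMatrix_one]

theorem single_mul_permMatrix (i j : n) (a : R) (σ : Equiv.Perm n) :
    single i j a * σ.permMatrix R = single i (σ j) a := by
  ext k l
  simp [PEquiv.mul_toMatrix_toPEquiv, single_apply, Equiv.eq_symm_apply]

theorem adjoin_mul_transpose_eq_one_eq_top [Invertible (2 : R)] :
    Algebra.adjoin R {A : Matrix n n R | A * A.transpose = 1} = ⊤ := by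
  set S := Algebra.adjoin R {A : Matrix n n R | A * A.transpose = 1}
  have diag_mem (i : n) : single i i (1 : R) ∈ S := by
    have h : single i i (1 : R) = (⅟2 : R) • (1 - (1 - (2 : R) • single i i (1 : R))) := by
      rw [sub_sub_cancel, smul_smul, invOf_mul_self, one_smul]
    rw [h]
    exact S.smul_mem (S.sub_mem S.one_mem
      (Algebra.subset_adjoin (one_sub_two_smul_single_mul_transpose i))) _
  have single_mem (i j : n) (a : R) : single i j a ∈ S := by
    have h : single i j a =
        a • (single i i (1 : R) * (Equiv.swap i j).permMatrix R) := by
      rw [single_mul_permMatrix, Equiv.swap_apply_left, smul_single, smul_eq_mul, mul_one]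
    rw [h]
    exact S.smul_mem (S.mul_mem (diag_mem i)
      (Algebra.subset_adjoin (permMatrix_mul_transpose _))) _
  refine eq_top_iff.2 fun A _ => ?_
  rw [matrix_eq_sum_single A]
  exact S.sum_mem fun i _ => S.sum_mem fun j _ => single_mem i j _

end Matrix


/-- Let `F` be an algebraically closed field of characteristic `0` and `n` a positive integer.
The `F`-subalgebra of the matrix algebra `Mₙ(F)` generated by the orthogonal group
`{A | A * A.transpose = 1}` is all of `Mₙ(F)`. -/
theorem matrix_algebra_adjoin_orthogonalGroup_eq_top
    (F : Type*) [Field F] [IsAlgClosed F] [CharZero F]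
    (n : ℕ) (hn : 0 < n) :
    Algebra.adjoin F {A : Matrix (Fin n) (Fin n) F | A * A.transpose = 1} = ⊤ := by
  have : Invertible (2 : F) := invertibleOfNonzero two_ne_zero
  exact Matrix.adjoin_mul_transpose_eq_one_eq_top
end

section
/- Let F be an algebraically closed field of characteristic 0 and m a positive integer. Let J ∈ M₂ₘ(F) be the standard skew-symmetric matrix with block form ((0, 1ₘ), (−1ₘ, 0)). The F-subalgebra of M₂ₘ(F) generated by the symplectic group Sp₂ₘ(F) = {A ∈ M₂ₘ(F) | Aᵀ·J·A = J} is all of M₂ₘ(F). -/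
open Matrix in
/-- A subalgebra of `2n × 2n` matrices containing all upper and lower symplectic shears is
the whole matrix algebra. -/
theorem Subalgebra.eq_top_of_symplectic_shears_mem {n R : Type*} [Fintype n] [DecidableEq n]
    [CommRing R] (S : Subalgebra R (Matrix (n ⊕ n) (n ⊕ n) R))
    (hu : ∀ B : Matrix n n R, Bᵀ = B → fromBlocks 1 B 0 1 ∈ S)
    (hl : ∀ C : Matrix n n R, Cᵀ = C → fromBlocks 1 0 C 1 ∈ S) : S = ⊤ := by
  have hupper : ∀ B : Matrix n n R, Bᵀ = B → fromBlocks 0 B 0 0 ∈ S := fun B hB ↦ by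
    have h := S.sub_mem (hu B hB) S.one_mem
    rwa [← fromBlocks_one, sub_eq_add_neg, fromBlocks_neg, fromBlocks_add, add_neg_cancel,
      neg_zero, add_zero, add_zero] at h
  have hlower : ∀ C : Matrix n n R, Cᵀ = C → fromBlocks 0 0 C 0 ∈ S := fun C hC ↦ by
    have h := S.sub_mem (hl C hC) S.one_mem
    rwa [← fromBlocks_one, sub_eq_add_neg, fromBlocks_neg, fromBlocks_add, add_neg_cancel,
      neg_zero, add_zero, add_zero] at h
  have hprod : ∀ B C : Matrix n n R, Bᵀ = B → Cᵀ = C → fromBlocks (B * C) 0 0 0 ∈ S :=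
    fun B C hB hC ↦ by
      simpa [fromBlocks_multiply] using S.mul_mem (hupper B hB) (hlower C hC)
  have hcorner : ∀ A : Matrix n n R, fromBlocks A 0 0 0 ∈ S := fun A ↦ by
    induction A using Matrix.induction_on' with
    | h_zero => simp [S.zero_mem]
    | h_add A B hA hB => simpa [fromBlocks_add] using S.add_mem hA hB
    | h_std_basis i j x =>
      by_cases hij : i = j
      · subst hij
        simpa using hprod (single i i x) 1 (by simp) (by simp)
      · have h := hprod (single i j x + single j i x) (single j j 1)
          (by simp [add_comm]) (by simp)
        simpa [add_mul, hij] using h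
  have hX : fromBlocks 0 1 0 0 ∈ S := hupper 1 transpose_one
  have hY : fromBlocks 0 0 1 0 ∈ S := hlower 1 transpose_one
  refine eq_top_iff.2 fun M _ ↦ ?_
  have h := S.add_mem (S.add_mem (hcorner M.toBlocks₁₁) (S.mul_mem (hcorner M.toBlocks₁₂) hX))
    (S.add_mem (S.mul_mem hY (hcorner M.toBlocks₂₁))
      (S.mul_mem (S.mul_mem hY (hcorner M.toBlocks₂₂)) hX))
  simpa [fromBlocks_multiply, fromBlocks_add, fromBlocks_toBlocks] using h


/-- Let `F` be an algebraically closed field of characteristic `0` and `m` a positive integer.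
Let `J` be the standard skew-symmetric matrix `fromBlocks 0 1 (-1) 0` of size `2m`.  The
`F`-subalgebra of `M₂ₘ(F)` generated by the symplectic group `{A | Aᵀ * J * A = J}` is all of
`M₂ₘ(F)`. -/
theorem matrix_algebra_adjoin_symplecticGroup_eq_top
    (F : Type*) [Field F] [IsAlgClosed F] [CharZero F]
    (m : ℕ) (hm : 0 < m) :
    Algebra.adjoin F
      {A : Matrix (Fin m ⊕ Fin m) (Fin m ⊕ Fin m) F |
        A.transpose * Matrix.fromBlocks 0 1 (-1) 0 * A =
          (Matrix.fromBlocks 0 1 (-1) 0 : Matrix (Fin m ⊕ Fin m) (Fin m ⊕ Fin m) F)} = ⊤ := by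
  refine Subalgebra.eq_top_of_symplectic_shears_mem _ (fun B hB ↦ Algebra.subset_adjoin ?_)
    (fun C hC ↦ Algebra.subset_adjoin ?_)
  · simp [Matrix.fromBlocks_transpose, Matrix.fromBlocks_multiply, hB]
  · simp [Matrix.fromBlocks_transpose, Matrix.fromBlocks_multiply, hC]
end

section
/- Let F be an algebraically closed field of characteristic 0 and n a positive integer. The F-subalgebra of the product algebra Mₙ(F) × Mₙ(F) generated by the set {(A, (Aᵀ)⁻¹) | A ∈ GLₙ(F)} is all of Mₙ(F) × Mₙ(F). -/
/-- Over an infinite field, every square matrix is a linear combination of invertible matrices. -/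
theorem Matrix.span_setOf_isUnit_eq_top {F ι : Type*} [Field F] [Infinite F] [Fintype ι]
    [DecidableEq ι] : Submodule.span F {M : Matrix ι ι F | IsUnit M} = ⊤ := by
  refine Submodule.eq_top_iff'.2 fun M => ?_
  obtain ⟨c, hc⟩ : ∃ c, M.charpoly.eval c ≠ 0 := by
    by_contra! h
    exact M.charpoly_monic.ne_zero (Polynomial.funext fun c => by simpa using h c)
  have hu : IsUnit (Matrix.scalar ι c - M) := by
    rw [Matrix.isUnit_iff_isUnit_det, ← Matrix.eval_charpoly]
    exact hc.isUnit
  have hM : M = c • (1 : Matrix ι ι F) - (Matrix.scalar ι c - M) := by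
    rw [Matrix.smul_one_eq_diagonal, Matrix.scalar_apply, sub_sub_cancel]
  rw [hM]
  exact sub_mem (Submodule.smul_mem _ _ (Submodule.subset_span isUnit_one))
    (Submodule.subset_span hu)


/-- Let `F` be an algebraically closed field of characteristic `0` and `n` a positive integer.
The `F`-subalgebra of the product algebra `Mₙ(F) × Mₙ(F)` generated by the set
`{(A, (Aᵀ)⁻¹) | A ∈ GLₙ(F)}` is all of `Mₙ(F) × Mₙ(F)`. -/
theorem prod_matrix_algebra_adjoin_GL_graph_eq_top
    (F : Type*) [Field F] [IsAlgClosed F] [CharZero F]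
    (n : ℕ) (hn : 0 < n) :
    Algebra.adjoin F
      {p : Matrix (Fin n) (Fin n) F × Matrix (Fin n) (Fin n) F |
        ∃ A : GL (Fin n) F,
          p = ((A : Matrix (Fin n) (Fin n) F), ((A : Matrix (Fin n) (Fin n) F).transpose)⁻¹)} = ⊤ := by
  set S := Algebra.adjoin F
      {p : Matrix (Fin n) (Fin n) F × Matrix (Fin n) (Fin n) F |
        ∃ A : GL (Fin n) F,
          p = ((A : Matrix (Fin n) (Fin n) F),
            ((A : Matrix (Fin n) (Fin n) F).transpose)⁻¹)}
  have graph_mem {A : Matrix (Fin n) (Fin n) F} (hA : IsUnit A) : (A, A.transpose⁻¹) ∈ S :=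
    Algebra.subset_adjoin ⟨hA.unit, rfl⟩
  have inl_one_mem : ((1, 0) : Matrix (Fin n) (Fin n) F × Matrix (Fin n) (Fin n) F) ∈ S := by
    have two_inv : ((2 : F) • (1 : Matrix (Fin n) (Fin n) F))⁻¹ = (2 : F)⁻¹ • 1 :=
      Matrix.inv_eq_left_inv (by simp [smul_smul])
    have two_unit : IsUnit ((2 : F) • (1 : Matrix (Fin n) (Fin n) F)) :=
      isUnit_one.smul (Units.mk0 (2 : F) two_ne_zero)
    have h := S.smul_mem (sub_mem (graph_mem two_unit) (S.smul_mem S.one_mem (2 : F)⁻¹))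
      (2 / 3 : F)
    convert h using 1
    rw [Matrix.transpose_smul, Matrix.transpose_one, two_inv]
    ext1
    · simp only [Prod.smul_fst, Prod.fst_sub, Prod.fst_one, ← sub_smul, smul_smul]
      norm_num
    · simp
  have inr_one_mem : ((0, 1) : Matrix (Fin n) (Fin n) F × Matrix (Fin n) (Fin n) F) ∈ S := by
    convert sub_mem S.one_mem inl_one_mem using 1
    ext1 <;> simp
  have inl_mem (M : Matrix (Fin n) (Fin n) F) : (M, 0) ∈ S := by
    have h : Submodule.span F {M : Matrix (Fin n) (Fin n) F | IsUnit M} ≤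
        S.toSubmodule.comap (LinearMap.inl F _ _) :=
      Submodule.span_le.2 fun A hA => by
        simpa using mul_mem inl_one_mem (graph_mem hA)
    rw [Matrix.span_setOf_isUnit_eq_top] at h
    exact h (Submodule.mem_top (x := M))
  have inr_mem (M : Matrix (Fin n) (Fin n) F) : (0, M) ∈ S := by
    have h : Submodule.span F {M : Matrix (Fin n) (Fin n) F | IsUnit M} ≤
        S.toSubmodule.comap (LinearMap.inr F _ _) :=
      Submodule.span_le.2 fun A hA => by
        have hA' : IsUnit A.transpose⁻¹ :=
          (Matrix.isUnit_nonsing_inv_iff).2 ((Matrix.isUnit_transpose A).2 hA)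
        have hdet : IsUnit A.det := (Matrix.isUnit_iff_isUnit_det A).1 hA
        simpa [Matrix.transpose_nonsing_inv, Matrix.nonsing_inv_nonsing_inv A hdet] using
          mul_mem inr_one_mem (graph_mem hA')
    rw [Matrix.span_setOf_isUnit_eq_top] at h
    exact h (Submodule.mem_top (x := M))
  refine eq_top_iff.2 fun p _ => ?_
  simpa using add_mem (inl_mem p.1) (inr_mem p.2)
end

section
/- Let k be a field of characteristic 0, E a finite étale k-algebra, V an E-module, and φ : V × V → k a k-bilinear form satisfying φ(e·v, w) = φ(v, e·w) for all e ∈ E and v, w ∈ V. Then there exists a unique E-bilinear form φ̃ : V × V → E such that φ(v,w) = Tr_{E/k}(φ̃(v,w)) for all v, w ∈ V. -/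
/-- In a reduced Artinian commutative ring every principal ideal is generated by an idempotent. -/
theorem exists_isIdempotentElem_mul_eq_self {R : Type*} [CommRing R] [IsReduced R]
    [IsArtinianRing R] (x : R) : ∃ z : R, IsIdempotentElem (x * z) ∧ x * z * x = x := by
  obtain ⟨n, z, hz⟩ := IsArtinian.exists_pow_succ_smul_dvd x (1 : R)
  simp only [smul_eq_mul, mul_one, Nat.succ_eq_add_one] at hz
  have hnil : IsNilpotent (x * (1 - x * z)) := by
    refine ⟨n + 1, ?_⟩
    rw [mul_pow, pow_succ (1 - x * z)]
    linear_combination (-(x * (1 - x * z) ^ n)) * hz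
  have hx : x * (1 - x * z) = 0 := hnil.eq_zero
  refine ⟨z, ?_, by linear_combination -hx⟩
  rw [IsIdempotentElem]
  linear_combination (-z) * hx

/-- In characteristic zero, the only idempotent of trace zero is zero. -/
theorem IsIdempotentElem.eq_zero_of_trace_eq_zero {k E : Type*} [Field k] [CharZero k]
    [CommRing E] [Algebra k E] [Module.Finite k E] {e : E} (he : IsIdempotentElem e)
    (h : Algebra.trace k E e = 0) : e = 0 := by
  have hidem : IsIdempotentElem (Algebra.lmul k E e) := he.map (Algebra.lmul k E)
  have hbot : Algebra.lmul k E e = 0 :=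
    LinearMap.IsIdempotentElem.eq_zero_of_trace_eq_zero hidem h
  simpa using LinearMap.congr_fun hbot 1

/-- The trace pairing of a finite-dimensional reduced algebra in characteristic zero separates
points. -/
theorem eq_zero_of_forall_trace_mul_eq_zero {k E : Type*} [Field k] [CharZero k]
    [CommRing E] [Algebra k E] [IsReduced E] [Module.Finite k E] {x : E}
    (h : ∀ y, Algebra.trace k E (x * y) = 0) : x = 0 := by
  have : IsArtinianRing E := IsArtinianRing.of_finite k E
  obtain ⟨z, hz, hzx⟩ := exists_isIdempotentElem_mul_eq_self x
  rw [← hzx, hz.eq_zero_of_trace_eq_zero (h z), zero_mul]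

/-- Every linear functional on a finite-dimensional reduced algebra in characteristic zero is
represented by the trace pairing. -/
theorem exists_forall_trace_mul_eq {k E : Type*} [Field k] [CharZero k]
    [CommRing E] [Algebra k E] [IsReduced E] [Module.Finite k E] (f : E →ₗ[k] k) :
    ∃ x : E, ∀ y, Algebra.trace k E (x * y) = f y := by
  have hinj : Function.Injective (Algebra.traceForm k E : E →ₗ[k] Module.Dual k E) := by
    refine (injective_iff_map_eq_zero _).mpr fun x hx => ?_
    exact eq_zero_of_forall_trace_mul_eq_zero fun y => LinearMap.congr_fun hx y
  obtain ⟨x, hx⟩ := (LinearMap.injective_iff_surjective_of_finrank_eq_finrank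
    (Subspace.dual_finrank_eq (K := k) (V := E)).symm).mp hinj f
  exact ⟨x, fun y => LinearMap.congr_fun hx y⟩

/-- Let `k` be a field of characteristic `0`, `E` a finite étale `k`-algebra (i.e. a nonzero
finite-dimensional commutative reduced `k`-algebra), `V` an `E`-module, and
`φ : V × V → k` a `k`-bilinear form satisfying `φ(e•v, w) = φ(v, e•w)`.  Then there exists a
unique `E`-bilinear form `φ̃ : V × V → E` with `φ(v,w) = Tr_{E/k}(φ̃(v,w))` for all `v, w`. -/
theorem existsUnique_bilinear_lift
    (k : Type*) [Field k] [CharZero k]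
    (E : Type*) [CommRing E] [Algebra k E] [Nontrivial E] [IsReduced E] [Module.Finite k E]
    (V : Type*) [AddCommGroup V] [Module E V] [Module k V] [IsScalarTower k E V]
    (φ : V →ₗ[k] V →ₗ[k] k)
    (hcompat : ∀ (e : E) (v w : V), φ (e • v) w = φ v (e • w)) :
    ∃! φt : V →ₗ[E] V →ₗ[E] E, ∀ v w : V, φ v w = Algebra.trace k E (φt v w) := by
  have hext : ∀ {x y : E},
      (∀ e, Algebra.trace k E (x * e) = Algebra.trace k E (y * e)) → x = y := fun h =>
    sub_eq_zero.mp <| eq_zero_of_forall_trace_mul_eq_zero (k := k) fun e => by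
      rw [sub_mul, map_sub, h, sub_self]
  have hrep : ∀ v w : V, ∃ x : E, ∀ e, Algebra.trace k E (x * e) = φ v (e • w) := fun v w =>
    exists_forall_trace_mul_eq (φ v ∘ₗ (LinearMap.toSpanSingleton E V w).restrictScalars k)
  choose g hg using hrep
  have hsmul_right : ∀ (c : E) (v w : V), g v (c • w) = c • g v w := fun c v w => hext fun e => by
    rw [hg, smul_eq_mul, mul_comm c, mul_assoc, hg, smul_smul, mul_comm]
  refine ⟨LinearMap.mk₂ E g (fun v₁ v₂ w => hext fun e => ?_) (fun c v w => hext fun e => ?_)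
    (fun v w₁ w₂ => hext fun e => ?_) hsmul_right, fun v w => ?_, fun ψ hψ => ?_⟩
  · simp only [add_mul, map_add, hg, LinearMap.add_apply]
  · rw [hg, hcompat, ← hsmul_right, hg, smul_smul, smul_smul, mul_comm]
  · simp only [add_mul, map_add, hg, smul_add]
  · simpa using (hg v w 1).symm
  · ext v w
    refine hext fun e => ?_
    rw [LinearMap.mk₂_apply, hg, hψ, map_smul, smul_eq_mul, mul_comm]
end

section
/- Let k be a field of characteristic 0, E a finite étale k-algebra equipped with a k-algebra involution e ↦ ē (a k-algebra automorphism of E with ē̄ = e for all e). Let V be an E-module and φ : V × V → k a symmetric k-bilinear form satisfying φ(e·v, w) = φ(v, ē·w) for all e ∈ E and v, w ∈ V. Then there exists a unique E-valued hermitian form φ̃ : V × V → E such that φ(v,w) = Tr_{E/k}(φ̃(v,w)) for all v, w ∈ V. Here 'hermitian form' means: φ̃ is additive in each variable, φ̃(e·v, w) = e·φ̃(v,w) and φ̃(v, e·w) = ē·φ̃(v,w) for all e ∈ E, and φ̃(w,v) is the conjugate of φ̃(v,w) under the involution. -/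
/-- In a reduced Artinian commutative ring every element is von Neumann regular. -/
theorem IsArtinianRing.exists_sq_mul_eq_self {R : Type*} [CommRing R] [IsArtinianRing R]
    [IsReduced R] (x : R) : ∃ y : R, x ^ 2 * y = x := by
  obtain ⟨n, y, hy⟩ := IsArtinian.exists_pow_succ_smul_dvd x (1 : R)
  simp only [smul_eq_mul, mul_one, Nat.succ_eq_add_one] at hy
  have hnil : (x * (1 - x * y)) ^ (n + 1) = 0 := by
    rw [pow_succ, mul_pow]
    linear_combination (-(1 - x * y) ^ n * x) * hy
  refine ⟨y, ?_⟩
  linear_combination -(pow_eq_zero_iff n.succ_ne_zero).mp hnil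

/-- The trace form of a finite-dimensional reduced commutative algebra over a field of
characteristic zero is nondegenerate. -/
theorem Algebra.traceForm_nondegenerate_of_isReduced (k E : Type*) [Field k] [CharZero k]
    [CommRing E] [Algebra k E] [IsReduced E] [Module.Finite k E] :
    (Algebra.traceForm k E).Nondegenerate := by
  have : IsArtinianRing E := IsArtinianRing.of_finite k E
  have hsymm : (Algebra.traceForm k E).IsSymm := Algebra.traceForm_isSymm k
  refine (LinearMap.IsRefl.nondegenerate_iff_separatingLeft hsymm.isRefl).mpr ?_
  intro x hx
  obtain ⟨y, hy⟩ := IsArtinianRing.exists_sq_mul_eq_self x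
  have hidem : IsIdempotentElem (x * y) := by
    unfold IsIdempotentElem
    linear_combination y * hy
  have htr : LinearMap.trace k E (Algebra.lmul k E (x * y)) = 0 := hx y
  have hzero : Algebra.lmul k E (x * y) = 0 :=
    (LinearMap.IsIdempotentElem.trace_eq_zero_iff (hidem.map (Algebra.lmul k E))).mp htr
  have hxy : x * y = 0 := by simpa using LinearMap.congr_fun hzero 1
  linear_combination x * hxy - hy

/-- If the trace form is nondegenerate, an element is determined by the traces of its multiples. -/
theorem Algebra.eq_of_forall_trace_mul_eq {k E : Type*} [CommRing k] [CommRing E] [Algebra k E]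
    (h : (Algebra.traceForm k E).Nondegenerate) {a b : E}
    (hab : ∀ e : E, Algebra.trace k E (a * e) = Algebra.trace k E (b * e)) : a = b := by
  refine sub_eq_zero.mp (h.1 _ fun e => ?_)
  rw [Algebra.traceForm_apply, sub_mul, map_sub, hab, sub_self]

/-- Let `k` be a field of characteristic `0`, `E` a finite étale `k`-algebra (i.e. a nonzero
finite-dimensional commutative reduced `k`-algebra) equipped with a `k`-algebra involution
`σ : e ↦ ē`.  Let `V` be an `E`-module and `φ : V × V → k` a symmetric `k`-bilinear form with
`φ(e•v, w) = φ(v, ē•w)`.  Then there is a unique `E`-valued hermitian form `φ̃ : V × V → E`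
(additive in each variable, `E`-linear in the first variable, `σ`-semilinear in the second, and
conjugate-symmetric) such that `φ(v,w) = Tr_{E/k}(φ̃(v,w))` for all `v, w`. -/
theorem existsUnique_hermitian_lift
    (k : Type*) [Field k] [CharZero k]
    (E : Type*) [CommRing E] [Algebra k E] [Nontrivial E] [IsReduced E] [Module.Finite k E]
    (σ : E ≃ₐ[k] E) (hσ : ∀ e : E, σ (σ e) = e)
    (V : Type*) [AddCommGroup V] [Module E V] [Module k V] [IsScalarTower k E V]
    (φ : V →ₗ[k] V →ₗ[k] k)
    (hsymm : ∀ v w : V, φ v w = φ w v)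
    (hcompat : ∀ (e : E) (v w : V), φ (e • v) w = φ v (σ e • w)) :
    ∃! φt : V → V → E,
      (∀ v v' w : V, φt (v + v') w = φt v w + φt v' w) ∧
      (∀ v w w' : V, φt v (w + w') = φt v w + φt v w') ∧
      (∀ (e : E) (v w : V), φt (e • v) w = e * φt v w) ∧
      (∀ (e : E) (v w : V), φt v (e • w) = σ e * φt v w) ∧
      (∀ v w : V, φt w v = σ (φt v w)) ∧
      (∀ v w : V, φ v w = Algebra.trace k E (φt v w)) := by
  have hnd := Algebra.traceForm_nondegenerate_of_isReduced k E
  have hsep {a b : E} := Algebra.eq_of_forall_trace_mul_eq hnd (a := a) (b := b)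
  have hcompat' (e : E) (v w : V) : φ v (e • w) = φ (σ e • v) w := by rw [hcompat, hσ]
  have hex (v w : V) : ∃ a : E, ∀ e : E, Algebra.trace k E (a * e) = φ (e • v) w :=
    ⟨((Algebra.traceForm k E).toDual hnd).symm
      (φ.flip w ∘ₗ (LinearMap.toSpanSingleton E V v).restrictScalars k),
      fun e => LinearMap.BilinForm.apply_toDual_symm_apply (hB := hnd) _ e⟩
  choose φt hφt using hex
  have hσtr (a : E) : Algebra.trace k E (σ a) = Algebra.trace k E a :=
    Algebra.trace_eq_of_algEquiv σ a
  have hleft (e : E) (v w : V) : φt (e • v) w = e * φt v w := hsep fun x => by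
    rw [hφt, smul_smul, ← hφt]
    congr 1
    ring
  have hconj (v w : V) : φt w v = σ (φt v w) := hsep fun x => by
    rw [hφt, hsymm, hcompat', ← hφt, ← hσtr, map_mul, hσ]
  refine ⟨φt, ⟨fun v v' w => hsep fun x => ?_, fun v w w' => hsep fun x => ?_, hleft,
    fun e v w => ?_, hconj, fun v w => ?_⟩, ?_⟩
  · simp only [add_mul, map_add, hφt, smul_add, LinearMap.add_apply]
  · simp only [add_mul, map_add, hφt]
  · rw [hconj, hleft, map_mul, ← hconj]
  · simpa using (hφt v w 1).symm
  · rintro ψ ⟨-, -, hψleft, -, -, hψtr⟩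
    funext v w
    exact hsep fun x => by rw [hφt, hψtr, hψleft, mul_comm]
end

section
/- Let E be a field of characteristic 0 and (U,q) a finite-dimensional quadratic space over E. Let q ⊥ ⟨1⟩ denote the quadratic form on U ⊕ E given by (u,a) ↦ q(u) + a², and q ⊥ ⟨1⟩ ⊥ ⟨1⟩ the quadratic form on U ⊕ E² given by (u,a,b) ↦ q(u) + a² + b². Then there is an E-linear isomorphism between the even Clifford algebra C⁺(U ⊕ E², q ⊥ ⟨1⟩ ⊥ ⟨1⟩) and the direct sum of two copies of the even Clifford algebra C⁺(U ⊕ E, q ⊥ ⟨1⟩), which is equivariant for the orthogonal group O(U,q): each isometry g of (U,q) extends by the identity to an isometry of the larger quadratic spaces, acts on the even Clifford algebras via the induced functorial algebra maps, and the isomorphism intertwines these actions for every g ∈ O(U,q). -/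
namespace CliffordAlgebra

section ProdSq

variable {R M N : Type*} [CommRing R] [AddCommGroup M] [Module R M] [AddCommGroup N] [Module R N]

theorem map_mem_evenOdd {Q : QuadraticForm R M} {Q' : QuadraticForm R N} (f : Q →qᵢ Q')
    {n : ZMod 2} {x : CliffordAlgebra Q} (hx : x ∈ evenOdd Q n) : map f x ∈ evenOdd Q' n := by
  have h : (evenOdd Q n).map (map f).toLinearMap ≤ evenOdd Q' n := by
    simp_rw [evenOdd, Submodule.map_iSup, Submodule.map_pow]
    refine iSup_mono fun i => pow_le_pow_left' ?_ _
    rintro _ ⟨_, ⟨m, rfl⟩, rfl⟩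
    exact ⟨f m, (map_apply_ι f m).symm⟩
  exact h (Submodule.mem_map_of_mem hx)

variable (Q : QuadraticForm R M)

/-- The action of the vectors of `M × R` on `CliffordAlgebra Q × CliffordAlgebra Q` obtained from
left multiplication, where a pair `(x, y)` stands for `x + y * e` with `e` the new unit vector. -/
def prodSqAction : M × R →ₗ[R] Module.End R (CliffordAlgebra Q × CliffordAlgebra Q) :=
  LinearMap.coprod
    ((LinearMap.prodMapLinear R (CliffordAlgebra Q) (CliffordAlgebra Q) (CliffordAlgebra Q)
        (CliffordAlgebra Q) R ∘ₗ (LinearMap.id.prod LinearMap.id)) ∘ₗ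
      (LinearMap.mul R (CliffordAlgebra Q)) ∘ₗ ι Q)
    (LinearMap.toSpanSingleton R _
      ((involute.toLinearMap ∘ₗ LinearMap.snd R _ _).prod
        (involute.toLinearMap ∘ₗ LinearMap.fst R _ _)))

theorem prodSqAction_apply (m : M × R) (p : CliffordAlgebra Q × CliffordAlgebra Q) :
    prodSqAction Q m p =
      (ι Q m.1 * p.1 + m.2 • involute p.2, ι Q m.1 * p.2 + m.2 • involute p.1) := by
  simp [prodSqAction]

/-- The representation of `CliffordAlgebra (Q.prod QuadraticMap.sq)` extending
`CliffordAlgebra.prodSqAction`. -/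
def prodSqRep :
    CliffordAlgebra (Q.prod (QuadraticMap.sq (R := R))) →ₐ[R]
      Module.End R (CliffordAlgebra Q × CliffordAlgebra Q) :=
  lift _ ⟨prodSqAction Q, fun m => by
    refine LinearMap.ext fun p => ?_
    have h (x : CliffordAlgebra Q) : ι Q m.1 * (ι Q m.1 * x) = Q m.1 • x := by
      rw [← mul_assoc, ι_sq_scalar, Algebra.smul_def]
    ext <;>
      simp [Module.End.mul_apply, prodSqAction_apply, Module.algebraMap_end_apply, mul_add, h,
        involute_involute, smul_smul]⟩

theorem prodSqRep_ι (m : M × R) : prodSqRep Q (ι _ m) = prodSqAction Q m :=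
  lift_ι_apply _ _ m

/-- The coordinates `(x, y)` of the element `x + y * e` of
`CliffordAlgebra (Q.prod QuadraticMap.sq)`, where `e` is the new unit vector. -/
def prodSqCoords :
    CliffordAlgebra (Q.prod (QuadraticMap.sq (R := R))) →ₗ[R]
      CliffordAlgebra Q × CliffordAlgebra Q :=
  LinearMap.applyₗ (1, 0) ∘ₗ (prodSqRep Q).toLinearMap

theorem prodSqCoords_apply (z : CliffordAlgebra (Q.prod (QuadraticMap.sq (R := R)))) :
    prodSqCoords Q z = prodSqRep Q z (1, 0) := rfl

theorem prodSqCoords_ι_mul (m : M × R)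
    (z : CliffordAlgebra (Q.prod (QuadraticMap.sq (R := R)))) :
    prodSqCoords Q (ι _ m * z) =
      (ι Q m.1 * (prodSqCoords Q z).1 + m.2 • involute (prodSqCoords Q z).2,
        ι Q m.1 * (prodSqCoords Q z).2 + m.2 • involute (prodSqCoords Q z).1) := by
  rw [prodSqCoords_apply, map_mul, Module.End.mul_apply, prodSqRep_ι, prodSqAction_apply]
  rfl

/-- The element `x + y * e` of `CliffordAlgebra (Q.prod QuadraticMap.sq)`, where `e` is the new
unit vector. -/
def prodSqMk :
    CliffordAlgebra Q × CliffordAlgebra Q →ₗ[R]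
      CliffordAlgebra (Q.prod (QuadraticMap.sq (R := R))) :=
  LinearMap.coprod (map (QuadraticMap.Isometry.inl Q QuadraticMap.sq)).toLinearMap
    (LinearMap.mulRight R (ι _ (0, 1)) ∘ₗ
      (map (QuadraticMap.Isometry.inl Q QuadraticMap.sq)).toLinearMap)

theorem prodSqMk_apply (p : CliffordAlgebra Q × CliffordAlgebra Q) :
    prodSqMk Q p = map (QuadraticMap.Isometry.inl Q QuadraticMap.sq) p.1 +
      map (QuadraticMap.Isometry.inl Q QuadraticMap.sq) p.2 * ι _ (0, 1) := by
  simp [prodSqMk]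

theorem prodSqRep_map_inl (x : CliffordAlgebra Q) (p : CliffordAlgebra Q × CliffordAlgebra Q) :
    prodSqRep Q (map (QuadraticMap.Isometry.inl Q QuadraticMap.sq) x) p =
      (x * p.1, x * p.2) := by
  induction x using CliffordAlgebra.induction generalizing p with
  | algebraMap r =>
    simp [Module.algebraMap_end_apply, Algebra.smul_def, Prod.ext_iff]
  | ι m => simp [prodSqRep_ι, prodSqAction_apply]
  | mul a b ha hb => simp [Module.End.mul_apply, ha, hb, mul_assoc]
  | add a b ha hb => simp [ha, hb, add_mul]

theorem prodSqCoords_prodSqMk (p : CliffordAlgebra Q × CliffordAlgebra Q) :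
    prodSqCoords Q (prodSqMk Q p) = p := by
  rw [prodSqMk_apply, prodSqCoords_apply, map_add, map_mul, LinearMap.add_apply,
    Module.End.mul_apply, prodSqRep_map_inl, prodSqRep_map_inl, prodSqRep_ι, prodSqAction_apply]
  simp

theorem ι_unit_mul_map_inl (x : CliffordAlgebra Q) :
    ι (Q.prod (QuadraticMap.sq (R := R))) (0, 1) *
        map (QuadraticMap.Isometry.inl Q QuadraticMap.sq) x =
      map (QuadraticMap.Isometry.inl Q QuadraticMap.sq) (involute x) * ι _ (0, 1) := by
  induction x using CliffordAlgebra.induction with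
  | algebraMap r => simp [Algebra.commutes]
  | ι m =>
    have h : (Q.prod (QuadraticMap.sq (R := R))).IsOrtho (0, 1) (m, 0) := by
      simp [QuadraticMap.isOrtho_def, add_comm]
    simpa using ι_mul_ι_comm_of_isOrtho h
  | mul a b ha hb => rw [map_mul, ← mul_assoc, ha, mul_assoc, hb, map_mul, map_mul, mul_assoc]
  | add a b ha hb => simp [ha, hb, add_mul, mul_add]

theorem ι_mul_prodSqMk (m : M × R) (p : CliffordAlgebra Q × CliffordAlgebra Q) :
    ι _ m * prodSqMk Q p = prodSqMk Q
      (ι Q m.1 * p.1 + m.2 • involute p.2, ι Q m.1 * p.2 + m.2 • involute p.1) := by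
  have hm : ι (Q.prod (QuadraticMap.sq (R := R))) m =
      ι _ (m.1, 0) + m.2 • ι _ (0, 1) := by
    rw [← map_smul, ← map_add]
    simp
  have he : ι (Q.prod (QuadraticMap.sq (R := R))) (0, 1) * ι _ (0, 1) = 1 := by
    simp [ι_sq_scalar]
  simp only [prodSqMk_apply, map_add, map_mul, map_smul, map_apply_ι,
    QuadraticMap.Isometry.inl_apply, hm, add_mul, mul_add, smul_mul_assoc, ← mul_assoc,
    ι_unit_mul_map_inl]
  simp only [mul_assoc, he, mul_one]
  abel

theorem prodSqMk_prodSqCoords (z : CliffordAlgebra (Q.prod (QuadraticMap.sq (R := R)))) :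
    prodSqMk Q (prodSqCoords Q z) = z := by
  induction z using CliffordAlgebra.left_induction with
  | algebraMap r =>
    simp [prodSqCoords_apply, prodSqMk_apply, Algebra.algebraMap_eq_smul_one]
  | add x y hx hy => rw [map_add, map_add, hx, hy]
  | ι_mul x m hx => rw [prodSqCoords_ι_mul, ← ι_mul_prodSqMk, hx]

theorem prodSqCoords_mem {z : CliffordAlgebra (Q.prod (QuadraticMap.sq (R := R)))}
    (hz : z ∈ evenOdd _ 0) :
    (prodSqCoords Q z).1 ∈ evenOdd Q 0 ∧ (prodSqCoords Q z).2 ∈ evenOdd Q 1 := by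
  have step (i j : ZMod 2) (hij : 1 + i = j) (c : R) (m : M) (x y : CliffordAlgebra Q)
      (hx : x ∈ evenOdd Q i) (hy : y ∈ evenOdd Q j) :
      ι Q m * x + c • involute y ∈ evenOdd Q j :=
    add_mem (hij ▸ SetLike.mul_mem_graded (ι_mem_evenOdd_one Q m) hx)
      (Submodule.smul_mem _ _ ((involute_mem_evenOdd_iff Q).2 hy))
  induction z, hz using even_induction with
  | algebraMap r =>
    simpa [prodSqCoords_apply, Module.algebraMap_end_apply, ← Algebra.algebraMap_eq_smul_one]
      using SetLike.algebraMap_mem_graded (evenOdd Q) r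
  | add x y _ _ hx hy =>
    rw [map_add]
    exact ⟨add_mem hx.1 hy.1, add_mem hx.2 hy.2⟩
  | ι_mul_ι_mul m₁ m₂ x _ hx =>
    rw [mul_assoc, prodSqCoords_ι_mul, prodSqCoords_ι_mul]
    have h₁ := step 0 1 rfl m₂.2 m₂.1 _ _ hx.1 hx.2
    have h₂ := step 1 0 rfl m₂.2 m₂.1 _ _ hx.2 hx.1
    exact ⟨step 1 0 rfl _ _ _ _ h₁ h₂, step 0 1 rfl _ _ _ _ h₂ h₁⟩

theorem prodSqMk_mem {p : CliffordAlgebra Q × CliffordAlgebra Q}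
    (h₁ : p.1 ∈ evenOdd Q 0) (h₂ : p.2 ∈ evenOdd Q 1) : prodSqMk Q p ∈ evenOdd _ 0 := by
  rw [prodSqMk_apply]
  exact add_mem (map_mem_evenOdd _ h₁)
    (SetLike.mul_mem_graded (i := (1 : ZMod 2)) (j := 1)
      (map_mem_evenOdd (QuadraticMap.Isometry.inl Q QuadraticMap.sq) h₂) (ι_mem_evenOdd_one _ _))

theorem prodSqCoords_map {f : Q →qᵢ Q}
    {f' : Q.prod (QuadraticMap.sq (R := R)) →qᵢ Q.prod (QuadraticMap.sq (R := R))}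
    (h : ∀ p, f' p = (f p.1, p.2)) (z : CliffordAlgebra (Q.prod (QuadraticMap.sq (R := R)))) :
    prodSqCoords Q (map f' z) = (map f (prodSqCoords Q z).1, map f (prodSqCoords Q z).2) := by
  have hcomp (x : CliffordAlgebra Q) :
      map f' (map (QuadraticMap.Isometry.inl Q QuadraticMap.sq) x) =
        map (QuadraticMap.Isometry.inl Q QuadraticMap.sq) (map f x) := by
    rw [← AlgHom.comp_apply, ← AlgHom.comp_apply, map_comp_map, map_comp_map]
    congr 2
    ext m <;> simp [h]
  conv_lhs => rw [← prodSqMk_prodSqCoords Q z, prodSqMk_apply]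
  rw [map_add, map_mul, hcomp, hcomp, map_apply_ι, h, map_zero,
    ← prodSqMk_apply Q (map f (prodSqCoords Q z).1, map f (prodSqCoords Q z).2),
    prodSqCoords_prodSqMk]

/-- If `Q` represents `1` at `c`, the even Clifford algebra of `Q ⊥ ⟨1⟩` is linearly isomorphic to
two copies of that of `Q`, with `(a, b)` corresponding to `a + b * c * e`. -/
def evenProdSqEquiv (c : M) (hc : Q c = 1) :
    evenOdd (Q.prod (QuadraticMap.sq (R := R))) 0 ≃ₗ[R] evenOdd Q 0 × evenOdd Q 0 where
  toFun z := (⟨(prodSqCoords Q z).1, (prodSqCoords_mem Q z.2).1⟩,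
    ⟨(prodSqCoords Q z).2 * ι Q c,
      SetLike.mul_mem_graded (i := (1 : ZMod 2)) (j := 1) (prodSqCoords_mem Q z.2).2
        (ι_mem_evenOdd_one Q c)⟩)
  map_add' x y := by ext <;> simp [add_mul]
  map_smul' r x := by ext <;> simp
  invFun p := ⟨prodSqMk Q (p.1, p.2 * ι Q c), prodSqMk_mem Q p.1.2
    (SetLike.mul_mem_graded (i := (0 : ZMod 2)) (j := 1) p.2.2 (ι_mem_evenOdd_one Q c))⟩
  left_inv z := by
    ext
    simp [mul_assoc, ι_sq_scalar, hc, prodSqMk_prodSqCoords]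
  right_inv p := by
    ext <;> simp [prodSqCoords_prodSqMk, mul_assoc, ι_sq_scalar, hc]

/-- An isometric equivalence induces a linear equivalence of the even (or odd) parts of the Clifford
algebras. -/
def evenOddEquivOfIsometry {Q : QuadraticForm R M} {Q' : QuadraticForm R N}
    (e : Q.IsometryEquiv Q') (n : ZMod 2) : evenOdd Q n ≃ₗ[R] evenOdd Q' n where
  toFun x := ⟨map e.toIsometry x, map_mem_evenOdd _ x.2⟩
  map_add' x y := by ext; simp
  map_smul' r x := by ext; simp
  invFun x := ⟨map e.symm.toIsometry x, map_mem_evenOdd _ x.2⟩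
  left_inv x := Subtype.ext ((equivOfIsometry e).symm_apply_apply x)
  right_inv x := Subtype.ext ((equivOfIsometry e).apply_symm_apply x)

end ProdSq

end CliffordAlgebra

/-- Reassociation of an orthogonal sum of three quadratic forms. -/
def QuadraticMap.IsometryEquiv.prodAssocSymm {R M₁ M₂ M₃ : Type*} [CommRing R]
    [AddCommGroup M₁] [AddCommGroup M₂] [AddCommGroup M₃] [Module R M₁] [Module R M₂] [Module R M₃]
    (Q₁ : QuadraticForm R M₁) (Q₂ : QuadraticForm R M₂) (Q₃ : QuadraticForm R M₃) :
    (Q₁.prod (Q₂.prod Q₃)).IsometryEquiv ((Q₁.prod Q₂).prod Q₃) where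
  toLinearEquiv := (LinearEquiv.prodAssoc R M₁ M₂ M₃).symm
  map_app' _ := add_assoc _ _ _

open CliffordAlgebra in

/-- Let `E` be a field of characteristic `0` and `(U, q)` a finite-dimensional quadratic space
over `E`.  Let `q ⊥ ⟨1⟩` be the quadratic form `(u, a) ↦ q u + a²` on `U ⊕ E` and
`q ⊥ ⟨1⟩ ⊥ ⟨1⟩` the form `(u, a, b) ↦ q u + a² + b²` on `U ⊕ E²`.  Then there is an `E`-linear
isomorphism between the even Clifford algebra `C⁺(U ⊕ E², q ⊥ ⟨1⟩ ⊥ ⟨1⟩)` and the direct sum of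
two copies of `C⁺(U ⊕ E, q ⊥ ⟨1⟩)` which is equivariant for `O(U, q)`: for every isometry `g` of
`(U, q)`, extended by the identity to isometries of the two larger quadratic spaces, the
isomorphism intertwines the functorially induced maps on the even Clifford algebras. -/
theorem exists_equivariant_linearEquiv_evenClifford_sum_two
    (E : Type*) [Field E] [CharZero E]
    (U : Type*) [AddCommGroup U] [Module E U] [FiniteDimensional E U]
    (q : QuadraticForm E U) :
    ∃ F : CliffordAlgebra.evenOdd (q.prod (QuadraticMap.sq.prod QuadraticMap.sq)) 0 ≃ₗ[E]
        (CliffordAlgebra.evenOdd (q.prod QuadraticMap.sq) 0 ×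
          CliffordAlgebra.evenOdd (q.prod QuadraticMap.sq) 0),
      ∀ g : U ≃ₗ[E] U, (∀ u : U, q (g u) = q u) →
        ∀ (fbig : QuadraticMap.Isometry (q.prod (QuadraticMap.sq.prod QuadraticMap.sq))
              (q.prod (QuadraticMap.sq.prod QuadraticMap.sq)))
          (fsmall : QuadraticMap.Isometry (q.prod QuadraticMap.sq) (q.prod QuadraticMap.sq)),
          (∀ p : U × E × E, fbig p = (g p.1, p.2)) →
          (∀ p : U × E, fsmall p = (g p.1, p.2)) →
          ∀ x y : CliffordAlgebra.evenOdd (q.prod (QuadraticMap.sq.prod QuadraticMap.sq)) 0,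
            CliffordAlgebra.map fbig
                (x : CliffordAlgebra (q.prod (QuadraticMap.sq.prod QuadraticMap.sq))) =
              (y : CliffordAlgebra (q.prod (QuadraticMap.sq.prod QuadraticMap.sq))) →
              ((F y).1 : CliffordAlgebra (q.prod QuadraticMap.sq)) =
                  CliffordAlgebra.map fsmall
                    ((F x).1 : CliffordAlgebra (q.prod QuadraticMap.sq)) ∧
                ((F y).2 : CliffordAlgebra (q.prod QuadraticMap.sq)) =
                  CliffordAlgebra.map fsmall
                    ((F x).2 : CliffordAlgebra (q.prod QuadraticMap.sq)) := by
  let e := QuadraticMap.IsometryEquiv.prodAssocSymm q (QuadraticMap.sq (R := E))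
    (QuadraticMap.sq (R := E))
  refine ⟨evenOddEquivOfIsometry e 0 ≪≫ₗ
    evenProdSqEquiv (q.prod QuadraticMap.sq) (0, 1) (by simp), ?_⟩
  intro g _ fbig fsmall hbig hsmall x y hxy
  let f' : (q.prod QuadraticMap.sq).prod (QuadraticMap.sq (R := E)) →qᵢ
      (q.prod QuadraticMap.sq).prod (QuadraticMap.sq (R := E)) :=
    { fsmall.toLinearMap.prodMap LinearMap.id with
      map_app' := fun p => by simp }
  have hf' (p : (U × E) × E) : f' p = (fsmall p.1, p.2) := rfl
  have hcomm : map e.toIsometry (y : CliffordAlgebra _) =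
      map f' (map e.toIsometry (x : CliffordAlgebra _)) := by
    rw [← hxy, ← AlgHom.comp_apply, ← AlgHom.comp_apply, map_comp_map, map_comp_map]
    congr 2
    refine QuadraticMap.Isometry.ext fun p => ?_
    change e (fbig p) = f' (e p)
    rw [hbig, hf', hsmall]
    rfl
  change (prodSqCoords _ (map e.toIsometry (y : CliffordAlgebra _))).1 =
      map fsmall (prodSqCoords _ (map e.toIsometry (x : CliffordAlgebra _))).1 ∧
    (prodSqCoords _ (map e.toIsometry (y : CliffordAlgebra _))).2 * ι _ (0, 1) =
      map fsmall ((prodSqCoords _ (map e.toIsometry (x : CliffordAlgebra _))).2 * ι _ (0, 1))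
  rw [hcomm, prodSqCoords_map _ hf', map_mul, map_apply_ι, hsmall, map_zero]
  exact ⟨rfl, rfl⟩
end
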